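/- arXiv:2003.11390 — 2 statements merged into one kernel-verified Lean document; each statement's English description precedes it below -/
import Mathlib

section
/- Let W_j be the fat point scheme obtained from W = m_1P_1+⋯+m_sP_s by decreasing the multiplicity of P_j by one, and let F_1,…,F_{ν_j} be a minimal set of separators of W_j in W with nondecreasing degrees. Then for each k, ((I_W + ⟨F_1,…,F_{k−1}⟩) : ⟨F_k⟩) = I_{P_j}, the vanishing prime of P_j. -/
open MvPolynomial

/-- The homogeneous vanishing ideal of the `K`-rational point of `ℙ^n` with homogeneous
coordinates `v`. -/
noncomputable def pointIdeal {K : Type*} [Field K] {n : ℕ} (v : Fin (n + 1) → K) :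
    Ideal (MvPolynomial (Fin (n + 1)) K) :=
  Ideal.span {F | (∃ d, F.IsHomogeneous d) ∧ MvPolynomial.eval v F = 0}

theorem MvPolynomial.IsHomogeneous.aeval_mul_left {σ R A : Type*} [CommSemiring R]
    [CommSemiring A] [Algebra R A] {F : MvPolynomial σ R} {d : ℕ} (hF : F.IsHomogeneous d)
    (a : A) (g : σ → A) :
    MvPolynomial.aeval (fun i => a * g i) F = a ^ d * MvPolynomial.aeval g F := by
  simp only [MvPolynomial.aeval_def, MvPolynomial.eval₂_eq, Finset.mul_sum]
  refine Finset.sum_congr rfl fun x hx => ?_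
  rw [hF.degree_eq_sum_deg_support hx]
  simp only [mul_pow, Finset.prod_mul_distrib, Finset.prod_pow_eq_pow_sum]
  ring

theorem eval_eq_zero_of_mem_pointIdeal {K : Type*} [Field K] {n : ℕ} {v : Fin (n + 1) → K}
    {F : MvPolynomial (Fin (n + 1)) K} (hF : F ∈ pointIdeal v) : MvPolynomial.eval v F = 0 := by
  have h : pointIdeal v ≤ RingHom.ker (MvPolynomial.eval v) :=
    Ideal.span_le.2 fun G hG => hG.2
  exact h hF

/-- Linear coordinates adapted to the point `v`, with `v i₀ ≠ 0`: the coordinate `X i₀` becomes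
the variable of the coefficient ring, and the linear forms `X i - (v i / v i₀) X i₀` become the
remaining variables. -/
noncomputable def pointCoordinates {K : Type*} [Field K] {n : ℕ} (v : Fin (n + 1) → K)
    (i₀ : Fin (n + 1)) (h₀ : v i₀ ≠ 0) :
    MvPolynomial (Fin (n + 1)) K ≃+* MvPolynomial {i // i ≠ i₀} (Polynomial K) :=
  RingEquiv.ofRingHom
    (MvPolynomial.aeval fun i => MvPolynomial.C (Polynomial.X * Polynomial.C (v i / v i₀)) +
      if h : i ≠ i₀ then MvPolynomial.X ⟨i, h⟩ else 0 :
        MvPolynomial (Fin (n + 1)) K →ₐ[K] MvPolynomial {i // i ≠ i₀} (Polynomial K)).toRingHom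
    (MvPolynomial.eval₂Hom
      (Polynomial.aeval (MvPolynomial.X i₀ : MvPolynomial (Fin (n + 1)) K)).toRingHom
      fun i => MvPolynomial.X i.1 - MvPolynomial.C (v i / v i₀) * MvPolynomial.X i₀)
    (by
      ext i
      · simp [MvPolynomial.algebraMap_apply]
      · simp [div_self h₀]
      · simp [i.2, MvPolynomial.algebraMap_apply, div_self h₀])
    (by
      ext i
      · simp
      · by_cases h : i = i₀
        · subst h
          simp [div_self h₀]
        · simp [h])

theorem pointCoordinates_apply {K : Type*} [Field K] {n : ℕ} (v : Fin (n + 1) → K)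
    (i₀ : Fin (n + 1)) (h₀ : v i₀ ≠ 0) (F : MvPolynomial (Fin (n + 1)) K) :
    pointCoordinates v i₀ h₀ F =
      MvPolynomial.aeval (fun i =>
        MvPolynomial.C (Polynomial.X * Polynomial.C (v i / v i₀)) +
          if h : i ≠ i₀ then MvPolynomial.X ⟨i, h⟩ else 0 :
        Fin (n + 1) → MvPolynomial {i // i ≠ i₀} (Polynomial K)) F := rfl

theorem pointCoordinates_symm_X {K : Type*} [Field K] {n : ℕ} (v : Fin (n + 1) → K)
    (i₀ : Fin (n + 1)) (h₀ : v i₀ ≠ 0) (i : {i // i ≠ i₀}) :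
    (pointCoordinates v i₀ h₀).symm (MvPolynomial.X i) =
      MvPolynomial.X i.1 - MvPolynomial.C (v i / v i₀) * MvPolynomial.X i₀ :=
  MvPolynomial.eval₂Hom_X' _ _ _

theorem MvPolynomial.mem_idealOfVars_iff_constantCoeff {σ R : Type*} [CommSemiring R]
    {p : MvPolynomial σ R} :
    p ∈ MvPolynomial.idealOfVars σ R ↔ MvPolynomial.constantCoeff p = 0 := by
  rw [← pow_one (MvPolynomial.idealOfVars σ R), MvPolynomial.mem_pow_idealOfVars_iff']
  simp [Finsupp.degree_eq_zero_iff, MvPolynomial.constantCoeff_eq]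

theorem constantCoeff_pointCoordinates {K : Type*} [Field K] {n : ℕ} (v : Fin (n + 1) → K)
    (i₀ : Fin (n + 1)) (h₀ : v i₀ ≠ 0) (F : MvPolynomial (Fin (n + 1)) K) :
    MvPolynomial.constantCoeff (pointCoordinates v i₀ h₀ F) =
      MvPolynomial.aeval (fun i => Polynomial.X * Polynomial.C (v i / v i₀)) F := by
  rw [pointCoordinates_apply]
  induction F using MvPolynomial.induction_on with
  | C a => simp [MvPolynomial.algebraMap_apply]
  | add p q hp hq => simp only [map_add, hp, hq]
  | mul_X p i hp =>
    rw [map_mul, map_mul, hp, map_mul]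
    by_cases h : i = i₀ <;> simp [h]

theorem pointIdeal_eq_comap_idealOfVars {K : Type*} [Field K] {n : ℕ} (v : Fin (n + 1) → K)
    (i₀ : Fin (n + 1)) (h₀ : v i₀ ≠ 0) :
    pointIdeal v = (MvPolynomial.idealOfVars {i // i ≠ i₀} (Polynomial K)).comap
      (pointCoordinates v i₀ h₀) := by
  apply le_antisymm
  · refine Ideal.span_le.2 ?_
    rintro F ⟨⟨d, hd⟩, hF⟩
    simp only [SetLike.mem_coe, Ideal.mem_comap]
    rw [MvPolynomial.mem_idealOfVars_iff_constantCoeff, constantCoeff_pointCoordinates]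
    have h := hd.aeval_mul_left (v i₀)⁻¹ v
    simp only [MvPolynomial.aeval_eq_eval, hF, mul_zero] at h
    rw [hd.aeval_mul_left]
    have h' := MvPolynomial.aeval_algebraMap_apply (Polynomial K) (fun i => (v i₀)⁻¹ * v i) F
    simp only [Polynomial.algebraMap_eq, MvPolynomial.aeval_eq_eval, h,
      map_zero] at h'
    simp only [div_eq_inv_mul]
    exact mul_eq_zero_of_right _ h'
  · rw [← Ideal.map_symm, Ideal.map_span, Ideal.span_le]
    rintro _ ⟨_, ⟨i, rfl⟩, rfl⟩
    refine Ideal.subset_span ⟨⟨1, ?_⟩, ?_⟩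
    · rw [pointCoordinates_symm_X]
      exact (MvPolynomial.isHomogeneous_X _ _).sub (MvPolynomial.isHomogeneous_C_mul_X _ _)
    · rw [pointCoordinates_symm_X]
      simp [h₀]

theorem mem_pointIdeal_pow_iff {K : Type*} [Field K] {n : ℕ} {v : Fin (n + 1) → K}
    {i₀ : Fin (n + 1)} (h₀ : v i₀ ≠ 0) {k : ℕ} {F : MvPolynomial (Fin (n + 1)) K} :
    F ∈ pointIdeal v ^ k ↔
      pointCoordinates v i₀ h₀ F ∈
        MvPolynomial.idealOfVars {i // i ≠ i₀} (Polynomial K) ^ k := by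
  rw [pointIdeal_eq_comap_idealOfVars v i₀ h₀, ← Ideal.map_symm, ← Ideal.map_pow,
    Ideal.map_symm, Ideal.mem_comap]

theorem mem_pointIdeal_iff {K : Type*} [Field K] {n : ℕ} {v : Fin (n + 1) → K}
    {i₀ : Fin (n + 1)} (h₀ : v i₀ ≠ 0) {F : MvPolynomial (Fin (n + 1)) K} :
    F ∈ pointIdeal v ↔ MvPolynomial.constantCoeff (pointCoordinates v i₀ h₀ F) = 0 := by
  rw [pointIdeal_eq_comap_idealOfVars v i₀ h₀, Ideal.mem_comap,
    MvPolynomial.mem_idealOfVars_iff_constantCoeff]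

theorem MvPolynomial.coeff_mul_of_mem_pow_idealOfVars {σ R : Type*} [CommRing R] {k : ℕ}
    {p : MvPolynomial σ R} (hp : p ∈ MvPolynomial.idealOfVars σ R ^ k) (g : MvPolynomial σ R)
    {x : σ →₀ ℕ} (hx : x.degree = k) :
    (g * p).coeff x = MvPolynomial.constantCoeff g * p.coeff x := by
  have hg : g - MvPolynomial.C (MvPolynomial.constantCoeff g) ∈
      MvPolynomial.idealOfVars σ R := by
    simp [MvPolynomial.mem_idealOfVars_iff_constantCoeff]
  have h := Ideal.mul_mem_mul hg hp
  rw [← pow_succ', MvPolynomial.mem_pow_idealOfVars_iff'] at h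
  have h' := h x (by omega)
  rw [sub_mul, MvPolynomial.coeff_sub, MvPolynomial.coeff_C_mul] at h'
  exact sub_eq_zero.1 h'

theorem exists_mem_pointIdeal_eval_ne_zero {K : Type*} [Field K] {n : ℕ}
    {v w : Fin (n + 1) → K} (hv : v ≠ 0) (hw : ∀ c : K, w ≠ c • v) :
    ∃ F ∈ pointIdeal v, MvPolynomial.eval w F ≠ 0 := by
  obtain ⟨a, ha⟩ := Function.ne_iff.1 hv
  by_contra! h
  refine hw (w a / v a) (funext fun b => ?_)
  have := h (MvPolynomial.C (v a) * MvPolynomial.X b - MvPolynomial.C (v b) * MvPolynomial.X a)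
    (Ideal.subset_span ⟨⟨1, (MvPolynomial.isHomogeneous_C_mul_X _ _).sub
      (MvPolynomial.isHomogeneous_C_mul_X _ _)⟩, by simp [mul_comm]⟩)
  simp only [map_sub, map_mul, MvPolynomial.eval_C, MvPolynomial.eval_X] at this
  simp only [Pi.zero_apply] at ha
  simp only [Pi.smul_apply, smul_eq_mul]
  field_simp
  linear_combination this

theorem card_finsuppAntidiag_ne {n : ℕ} (i₀ : Fin (n + 1)) {m : ℕ} (hm : 1 ≤ m)
    (hn : n = 0 → m = 1) :
    (Finset.finsuppAntidiag (Finset.univ : Finset {i : Fin (n + 1) // i ≠ i₀}) (m - 1)).card =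
      (m + n - 2).choose (n - 1) := by
  rw [Finset.card_finsuppAntidiag_nat_eq_multichoose]
  have : (Finset.univ : Finset {i : Fin (n + 1) // i ≠ i₀}).card = n := by simp
  rw [this]
  rcases Nat.eq_zero_or_pos n with rfl | h
  · simp [hn rfl]
  · rw [Nat.multichoose_eq, ← Nat.choose_symm (by omega)]
    congr 1 <;> omega

/-- A square family of vectors over a domain is linearly independent as soon as its span contains
a nonzero multiple of each basis vector. -/
theorem Matrix.eq_zero_of_vecMul_eq_zero_of_smul_single {R ι : Type*} [CommRing R] [IsDomain R]
    [Fintype ι] [DecidableEq ι] {W : Matrix ι ι R} {r : R} (hr : r ≠ 0)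
    (hW : ∀ i, ∃ b : ι → R, Matrix.vecMul b W = r • Pi.single i 1) {c : ι → R} (hc : Matrix.vecMul c W = 0) :
    c = 0 := by
  choose B hB using hW
  refine Matrix.eq_zero_of_vecMul_eq_zero (M := W) (fun hdet => ?_) hc
  have hBW : Matrix.of B * W = r • (1 : Matrix ι ι R) := by
    ext i j
    have := congrFun (hB i) j
    simpa [Matrix.mul_apply, Matrix.vecMul, dotProduct, Matrix.one_apply, Pi.single_apply,
      eq_comm] using this
  have h := congrArg Matrix.det hBW
  rw [Matrix.det_mul, hdet, mul_zero, Matrix.det_smul, Matrix.det_one, mul_one] at h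
  exact pow_ne_zero _ hr h.symm

/-- Let `W_j` be obtained from the fat point scheme
`W = m_1 P_1 + ⋯ + m_s P_s` by decreasing the multiplicity of `P_j` by one, and let
`F_1, …, F_{ν_j}` be a minimal set of separators of `W_j` in `W` with nondecreasing
degrees, where `ν_j = C(m_j + n - 2, n - 1)`. Then for each `k`,
`((I_W + ⟨F_1, …, F_{k-1}⟩) : ⟨F_k⟩) = I_{P_j}`. -/
theorem separator_colon_eq_pointIdeal {K : Type*} [Field K] (n s : ℕ) (hs : 0 < s)
    (v : Fin s → (Fin (n + 1) → K))
    (hv0 : ∀ j, v j ≠ 0)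
    (hdist : ∀ i j, i ≠ j → ∀ c : K, v i ≠ c • v j)
    (m : Fin s → ℕ) (hm : ∀ j, 1 ≤ m j)
    (j₀ : Fin s)
    -- `I_W` and `I_{W_{j₀}}`
    (IW IWj : Ideal (MvPolynomial (Fin (n + 1)) K))
    (hIW : IW = ⨅ j, (pointIdeal (v j)) ^ (m j))
    (hIWj : IWj = ⨅ j, (pointIdeal (v j)) ^ (if j = j₀ then m j - 1 else m j))
    -- a minimal set of separators of `W_{j₀}` in `W`, with nondecreasing degrees
    (F : Fin ((m j₀ + n - 2).choose (n - 1)) → MvPolynomial (Fin (n + 1)) K)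
    (d : Fin ((m j₀ + n - 2).choose (n - 1)) → ℕ)
    (hFhom : ∀ k, (F k).IsHomogeneous (d k))
    (hday : Monotone d)
    (hFsep : ∀ k, F k ∈ IWj ∧ F k ∉ IW)
    (hFmin : IWj = IW + Ideal.span (Set.range F)) :
    ∀ k, Submodule.colon
        ((IW ⊔ Ideal.span (F '' {l | l < k}) : Ideal (MvPolynomial (Fin (n + 1)) K)) :
          Submodule (MvPolynomial (Fin (n + 1)) K) (MvPolynomial (Fin (n + 1)) K))
        (Ideal.span {F k}) =
      pointIdeal (v j₀) := by
  intro k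
  obtain ⟨i₀, h₀⟩ := Function.ne_iff.1 (hv0 j₀)
  have h₀ : v j₀ i₀ ≠ 0 := h₀
  set ψ := pointCoordinates (v j₀) i₀ h₀ with hψ
  have hIW_mem : ∀ {G}, G ∈ IW ↔ ∀ j, G ∈ pointIdeal (v j) ^ m j := by
    intro G; rw [hIW, Ideal.mem_iInf]
  have hIWj_mem : ∀ {G}, G ∈ IWj ↔
      ∀ j, G ∈ pointIdeal (v j) ^ (if j = j₀ then m j - 1 else m j) := by
    intro G; rw [hIWj, Ideal.mem_iInf]
  have hle : ∀ {G}, G ∈ IWj →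
      ψ G ∈ MvPolynomial.idealOfVars {i // i ≠ i₀} (Polynomial K) ^ (m j₀ - 1) := by
    intro G hG
    have := hIWj_mem.1 hG j₀
    rw [if_pos rfl] at this
    exact (mem_pointIdeal_pow_iff h₀).1 this
  have hcoeff : ∀ {G}, G ∈ IW → ∀ x, x.degree = m j₀ - 1 → (ψ G).coeff x = 0 := by
    intro G hG x hx
    have := (mem_pointIdeal_pow_iff h₀).1 (hIW_mem.1 hG j₀)
    have hm' := hm j₀
    exact (MvPolynomial.mem_pow_idealOfVars_iff' _ _).1 this x (by omega)
  have hn : n = 0 → m j₀ = 1 := by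
    intro hn
    by_contra hne
    have hm' := hm j₀
    have hempty : IsEmpty {i : Fin (n + 1) // i ≠ i₀} := by
      subst hn
      exact ⟨fun i => i.2 (by omega)⟩
    have hFk : ψ (F k) = 0 := by
      ext1 x
      refine (MvPolynomial.mem_pow_idealOfVars_iff' _ _).1 (hle (hFsep k).1) x ?_
      rw [Subsingleton.elim x 0]
      simp only [map_zero]
      omega
    apply (hFsep k).2
    rw [(map_eq_zero_iff ψ ψ.injective).1 hFk]
    exact zero_mem _
  have hcard := card_finsuppAntidiag_ne i₀ (hm j₀) hn
  let e := (Finset.equivFinOfCardEq hcard).symm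
  have hdeg : ∀ a, (e a).1.degree = m j₀ - 1 := by
    intro a
    have := (Finset.mem_finsuppAntidiag.1 (e a).2).1
    rw [Finsupp.degree_eq_sum]
    exact this
  let W : Matrix (Fin ((m j₀ + n - 2).choose (n - 1))) (Fin ((m j₀ + n - 2).choose (n - 1)))
    (Polynomial K) := Matrix.of fun l a => (ψ (F l)).coeff (e a).1
  have hvecMul : ∀ (b : Fin ((m j₀ + n - 2).choose (n - 1)) → MvPolynomial (Fin (n + 1)) K) a,
      (Matrix.vecMul (fun l => MvPolynomial.constantCoeff (ψ (b l))) W) a =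
        (ψ (∑ l, b l * F l)).coeff (e a).1 := by
    intro b a
    simp only [Matrix.vecMul, dotProduct, W, Matrix.of_apply, map_sum, map_mul,
      MvPolynomial.coeff_sum]
    refine Finset.sum_congr rfl fun l _ => ?_
    rw [MvPolynomial.coeff_mul_of_mem_pow_idealOfVars (hle (hFsep l).1) _ (hdeg a)]
  obtain ⟨h, hh, hh0⟩ : ∃ h, (∀ j, j ≠ j₀ → h ∈ pointIdeal (v j) ^ m j) ∧
      MvPolynomial.eval (v j₀) h ≠ 0 := by
    have hex : ∀ j, ∃ p, (j ≠ j₀ → p ∈ pointIdeal (v j)) ∧ MvPolynomial.eval (v j₀) p ≠ 0 := by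
      intro j
      by_cases hj : j = j₀
      · exact ⟨1, fun h => absurd hj h, by simp⟩
      · obtain ⟨p, hp, hp0⟩ := exists_mem_pointIdeal_eval_ne_zero (hv0 j)
          (hdist j₀ j (Ne.symm hj))
        exact ⟨p, fun _ => hp, hp0⟩
    choose p hp hp0 using hex
    refine ⟨∏ j, p j ^ m j, fun j hj => ?_, ?_⟩
    · exact Ideal.mem_of_dvd _ (Finset.dvd_prod_of_mem _ (Finset.mem_univ j))
        (Ideal.pow_mem_pow (hp j hj) _)
    · rw [map_prod]
      exact Finset.prod_ne_zero_iff.2 fun j _ => by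
        rw [map_pow]; exact pow_ne_zero _ (hp0 j)
  have hr : MvPolynomial.constantCoeff (ψ h) ≠ 0 := fun hz =>
    hh0 (eval_eq_zero_of_mem_pointIdeal ((mem_pointIdeal_iff h₀).2 hz))
  have hspan : ∀ a, ∃ b : Fin ((m j₀ + n - 2).choose (n - 1)) → Polynomial K,
      Matrix.vecMul b W = MvPolynomial.constantCoeff (ψ h) • Pi.single a 1 := by
    intro a
    have hmon : MvPolynomial.monomial (e a).1 (1 : Polynomial K) ∈
        MvPolynomial.idealOfVars {i // i ≠ i₀} (Polynomial K) ^ (m j₀ - 1) := by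
      rw [MvPolynomial.monomial_mem_pow_idealOfVars_iff _ _ one_ne_zero, hdeg]
    have hmem : h * ψ.symm (MvPolynomial.monomial (e a).1 1) ∈ IWj := by
      refine hIWj_mem.2 fun j => ?_
      split_ifs with hj
      · subst hj
        refine Ideal.mul_mem_left _ _ ((mem_pointIdeal_pow_iff h₀).2 ?_)
        rw [← hψ, RingEquiv.apply_symm_apply]
        exact hmon
      · exact Ideal.mul_mem_right _ _ (hh j hj)
    rw [hFmin] at hmem
    obtain ⟨w, hw, y, hy, hwy⟩ := Submodule.mem_sup.1 hmem
    obtain ⟨b, rfl⟩ := Ideal.mem_span_range_iff_exists_fun.1 hy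
    refine ⟨fun l => MvPolynomial.constantCoeff (ψ (b l)), funext fun a' => ?_⟩
    rw [hvecMul, eq_sub_of_add_eq' hwy, map_sub, MvPolynomial.coeff_sub,
      hcoeff hw _ (hdeg a'), sub_zero, map_mul, RingEquiv.apply_symm_apply,
      MvPolynomial.coeff_mul_of_mem_pow_idealOfVars hmon _ (hdeg a')]
    classical
    rw [MvPolynomial.coeff_monomial]
    simp only [Subtype.coe_inj, e.injective.eq_iff, Pi.smul_apply, Pi.single_apply, smul_eq_mul,
      eq_comm]
  ext G
  rw [Ideal.mem_colon_span_singleton]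
  constructor
  · intro hG
    obtain ⟨w, hw, y, hy, hwy⟩ := Submodule.mem_sup.1 hG
    obtain ⟨c, hc, rfl⟩ := (Finsupp.mem_span_image_iff_linearCombination _).1 hy
    have hck : c k = 0 := by
      by_contra hne
      exact lt_irrefl k ((Finsupp.mem_supported _ _).1 hc (Finsupp.mem_support_iff.2 hne))
    rw [Finsupp.linearCombination_apply, Finsupp.sum_fintype _ _ (by simp)] at hwy
    simp only [smul_eq_mul] at hwy
    let b : Fin ((m j₀ + n - 2).choose (n - 1)) → MvPolynomial (Fin (n + 1)) K :=
      Pi.single k G - ⇑c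
    have hzero := Matrix.eq_zero_of_vecMul_eq_zero_of_smul_single hr hspan
      (c := fun l => MvPolynomial.constantCoeff (ψ (b l))) (by
        funext a
        rw [hvecMul, show ∑ l, b l * F l = w by
          simp only [b, Pi.sub_apply, sub_mul, Finset.sum_sub_distrib, Pi.single_apply, ite_mul,
            zero_mul, Finset.sum_ite_eq', Finset.mem_univ, if_true]
          linear_combination -hwy]
        exact hcoeff hw _ (hdeg a))
    have hk := congrFun hzero k
    simp only [b, Pi.sub_apply, Pi.single_eq_same, hck, sub_zero, Pi.zero_apply] at hk
    exact (mem_pointIdeal_iff h₀).2 hk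
  · intro hG
    refine Ideal.mem_sup_left (hIW_mem.2 fun j => ?_)
    have hFk := hIWj_mem.1 (hFsep k).1 j
    split_ifs at hFk with hj
    · subst hj
      have := Ideal.mul_mem_mul hG hFk
      rwa [← pow_succ', Nat.sub_add_cancel (hm j)] at this
    · exact Ideal.mul_mem_left _ _ hFk
end

section
/- Let X be a finite set of distinct points in P^n (s ≥ 2, char K = 0), let Y be a nonempty subset of X, and let k, ℓ ≥ 0 be integers. Then for all sufficiently large i, the degree-i component of I_X^k · I_Y^ℓ is contained in the degree-i component of ∂(I_X^{k+1} · I_Y^ℓ). -/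
open MvPolynomial

/-- The ideal `∂I` generated by all partial derivatives of elements of `I`. -/
noncomputable def partialsIdeal {K : Type*} [Field K] {n : ℕ}
    (I : Ideal (MvPolynomial (Fin (n + 1)) K)) : Ideal (MvPolynomial (Fin (n + 1)) K) :=
  Ideal.span {g | ∃ F ∈ I, ∃ j : Fin (n + 1), g = pderiv j F}

section PartialsOfPointIdeals

open scoped Pointwise

attribute [local instance] MvPolynomial.gradedAlgebra

variable {K : Type*} [Field K] {n : ℕ}

lemma pderiv_mem_partialsIdeal {I : Ideal (MvPolynomial (Fin (n + 1)) K)}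
    {F : MvPolynomial (Fin (n + 1)) K} (hF : F ∈ I) (j : Fin (n + 1)) :
    pderiv j F ∈ partialsIdeal I :=
  Ideal.subset_span ⟨F, hF, j, rfl⟩

/-- A homogeneous ideal is contained in the ideal of its partial derivatives, because
`∑ ∂(X_i G)/∂X_i = (n + 1 + d) G` for `G` homogeneous of degree `d`. -/
lemma le_partialsIdeal [CharZero K] {I : Ideal (MvPolynomial (Fin (n + 1)) K)}
    (hI : I.IsHomogeneous (homogeneousSubmodule (Fin (n + 1)) K)) : I ≤ partialsIdeal I := by
  intro F hF
  rw [← sum_homogeneousComponent F]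
  refine Ideal.sum_mem _ fun d _ => ?_
  set G := homogeneousComponent d F
  have hG : G ∈ I := homogeneousComponent_mem_of_mem hI hF d
  have euler := (homogeneousComponent_isHomogeneous d F).sum_X_mul_pderiv
  have key : ∑ i : Fin (n + 1), pderiv i (X i * G) = C ((n + 1 + d : ℕ) : K) * G := by
    simp only [Derivation.leibniz, pderiv_X_self, smul_eq_mul, Finset.sum_add_distrib, mul_one]
    rw [euler]
    simp
    ring
  have hne : ((n + 1 + d : ℕ) : K) ≠ 0 := Nat.cast_ne_zero.mpr (by omega)
  have : G = C (((n + 1 + d : ℕ) : K)⁻¹) * ∑ i : Fin (n + 1), pderiv i (X i * G) := by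
    rw [key, ← mul_assoc, ← C_mul, inv_mul_cancel₀ hne, C_1, one_mul]
  rw [this]
  exact Ideal.mul_mem_left _ _ (Ideal.sum_mem _ fun i _ =>
    pderiv_mem_partialsIdeal (I.mul_mem_left _ hG) i)

/-- The linear form `v_c X_i - v_i X_c`, which vanishes at `v`. -/
noncomputable def minorForm (v : Fin (n + 1) → K) (c i : Fin (n + 1)) :
    MvPolynomial (Fin (n + 1)) K :=
  C (v c) * X i - C (v i) * X c

lemma minorForm_mem_pointIdeal (v : Fin (n + 1) → K) (c i : Fin (n + 1)) :
    minorForm v c i ∈ pointIdeal v := by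
  refine Ideal.subset_span ⟨⟨1, ?_⟩, by simp [minorForm, mul_comm]⟩
  exact ((isHomogeneous_X K i).C_mul _).sub ((isHomogeneous_X K c).C_mul _)

lemma eval₂_mul_left_of_isHomogeneous {σ R S : Type*} [CommSemiring R] [CommSemiring S]
    {F : MvPolynomial σ R} {d : ℕ} (hF : F.IsHomogeneous d) (f : R →+* S) (t : S) (g : σ → S) :
    eval₂ f (fun i => t * g i) F = t ^ d * eval₂ f g F := by
  rw [MvPolynomial.eval₂_eq, MvPolynomial.eval₂_eq, Finset.mul_sum]
  refine Finset.sum_congr rfl fun m hm => ?_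
  have hd : ∑ i ∈ m.support, m i = d := by
    rw [← Finsupp.degree_apply, Finsupp.degree_eq_weight_one]
    exact hF (mem_support_iff.mp hm)
  simp only [mul_pow, Finset.prod_mul_distrib, Finset.prod_pow_eq_pow_sum, hd]
  ring

lemma pointIdeal_eq_span_minorForm {v : Fin (n + 1) → K} {c : Fin (n + 1)} (hc : v c ≠ 0) :
    pointIdeal v = Ideal.span (Set.range (minorForm v c)) := by
  refine le_antisymm (Ideal.span_le.mpr ?_) (Ideal.span_le.mpr ?_)
  · rintro F ⟨⟨d, hF⟩, hv⟩
    set q := Ideal.Quotient.mk (Ideal.span (Set.range (minorForm v c)))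
    have hX : ∀ i, q (X i) = q (C (v c)⁻¹ * X c) * q (C (v i)) := by
      intro i
      rw [← map_mul, Ideal.Quotient.eq]
      have : X i - C (v c)⁻¹ * X c * C (v i) = C (v c)⁻¹ * minorForm v c i := by
        have h1 : C (σ := Fin (n + 1)) (v c)⁻¹ * C (v c) = 1 := by
          rw [← C_mul, inv_mul_cancel₀ hc, C_1]
        rw [minorForm]
        linear_combination -(X i) * h1
      rw [this]
      exact Ideal.mul_mem_left _ _ (Ideal.subset_span ⟨i, rfl⟩)
    have hq : q F = eval₂ (q.comp C) (fun i => q (X i)) F := by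
      conv_lhs => rw [← eval₂_eta F]
      rw [hom_eval₂]
    refine Ideal.Quotient.eq_zero_iff_mem.mp ?_
    change q F = 0
    have hev : eval₂ (q.comp C) (fun i => (q.comp C) (v i)) F = (q.comp C) (eval v F) := by
      rw [eval₂_comp]
      rfl
    rw [hq, funext hX, eval₂_mul_left_of_isHomogeneous hF]
    change _ * eval₂ (q.comp C) (fun i => (q.comp C) (v i)) F = 0
    rw [hev, hv, map_zero, mul_zero]
  · rintro _ ⟨i, rfl⟩
    exact minorForm_mem_pointIdeal v c i

/-- Products of minor forms are eigenvectors of `L_i ∂_i`, with eigenvalue `m v_c`. -/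
lemma minorForm_mul_pderiv {v : Fin (n + 1) → K} {c i : Fin (n + 1)} (hi : i ≠ c) (e : ℕ) :
    ∀ G ∈ Set.range (minorForm v c) ^ e,
      ∃ m : ℕ, minorForm v c i * pderiv i G = C (m * v c) * G := by
  induction e with
  | zero =>
    intro G hG
    rw [pow_zero, Set.mem_one] at hG
    exact ⟨0, by simp [hG]⟩
  | succ e ih =>
    intro G hG
    rw [pow_succ] at hG
    obtain ⟨G, hG, _, ⟨j, rfl⟩, rfl⟩ := hG
    obtain ⟨m, hm⟩ := ih G hG
    by_cases hj : j = i
    · subst hj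
      refine ⟨m + 1, ?_⟩
      have h : pderiv j (minorForm v c j) = C (v c) := by
        simp [minorForm, pderiv_X_of_ne hi.symm]
      simp only [Derivation.leibniz, smul_eq_mul, h]
      push_cast
      rw [add_mul, map_add, one_mul]
      linear_combination minorForm v c j * hm
    · refine ⟨m, ?_⟩
      have h : pderiv i (minorForm v c j) = 0 := by
        simp [minorForm, pderiv_X_of_ne hi.symm, pderiv_X_of_ne hj]
      simp only [Derivation.leibniz, smul_eq_mul, h]
      linear_combination minorForm v c j * hm

lemma sq_mul_mem_partialsIdeal [CharZero K] {v : Fin (n + 1) → K} {c i : Fin (n + 1)}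
    (hc : v c ≠ 0) (hi : i ≠ c) {J : Ideal (MvPolynomial (Fin (n + 1)) K)}
    (hJ : J ≤ partialsIdeal J) {e : ℕ} {g : MvPolynomial (Fin (n + 1)) K}
    (hg : ∀ G ∈ pointIdeal v ^ (e + 1), g * G ∈ J) {G : MvPolynomial (Fin (n + 1)) K}
    (hG : G ∈ pointIdeal v ^ e) : g ^ 2 * G ∈ partialsIdeal J := by
  rw [pointIdeal_eq_span_minorForm hc, Ideal.span, Submodule.span_pow] at hG
  induction hG using Submodule.span_induction with
  | zero => simp
  | add x y _ _ hx hy => rw [mul_add]; exact Ideal.add_mem _ hx hy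
  | smul a x _ hx =>
    rw [smul_eq_mul, mul_left_comm]
    exact Ideal.mul_mem_left _ _ hx
  | mem G hG =>
    obtain ⟨m, hm⟩ := minorForm_mul_pderiv hi e G hG
    have hGp : G ∈ pointIdeal v ^ e := by
      rw [pointIdeal_eq_span_minorForm hc, Ideal.span, Submodule.span_pow]
      exact Submodule.subset_span hG
    have hLG : g * (minorForm v c i * G) ∈ J := by
      refine hg _ ?_
      rw [pow_succ']
      exact Ideal.mul_mem_mul (minorForm_mem_pointIdeal v c i) hGp
    have h : pderiv i (minorForm v c i) = C (v c) := by
      simp [minorForm, pderiv_X_of_ne hi.symm]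
    have hne : ((m + 1 : ℕ) : K) * v c ≠ 0 := mul_ne_zero (Nat.cast_ne_zero.mpr m.succ_ne_zero) hc
    have h1 : C (σ := Fin (n + 1)) (((m + 1 : ℕ) : K) * v c)⁻¹ * C (((m + 1 : ℕ) : K) * v c)
        = 1 := by
      rw [← C_mul, inv_mul_cancel₀ hne, C_1]
    have hC : C (σ := Fin (n + 1)) (((m + 1 : ℕ) : K) * v c) = C (m * v c) + C (v c) := by
      rw [← C_add]; push_cast; ring_nf
    have key : g ^ 2 * G = C (((m + 1 : ℕ) : K) * v c)⁻¹ *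
        (g * pderiv i (g * (minorForm v c i * G)) -
          pderiv i g * (g * (minorForm v c i * G))) := by
      simp only [Derivation.leibniz, smul_eq_mul, h]
      linear_combination (-(g ^ 2 * G)) * h1 + C (((m + 1 : ℕ) : K) * v c)⁻¹ * g ^ 2 * G * hC
        - C (((m + 1 : ℕ) : K) * v c)⁻¹ * g ^ 2 * hm
    rw [key]
    exact Ideal.mul_mem_left _ _ (Ideal.sub_mem _
      (Ideal.mul_mem_left _ _ (pderiv_mem_partialsIdeal hLG i))
      (Ideal.mul_mem_left _ _ (hJ hLG)))

/-- A prime ideal containing the ideals of two distinct points contains all the variables. -/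
lemma X_mem_of_pointIdeal_le {v w : Fin (n + 1) → K} (hw : w ≠ 0)
    (hvw : ∀ c : K, v ≠ c • w) {P : Ideal (MvPolynomial (Fin (n + 1)) K)} [P.IsPrime]
    (hv : pointIdeal v ≤ P) (hw' : pointIdeal w ≤ P) (a : Fin (n + 1)) : X a ∈ P := by
  obtain ⟨c, hc⟩ := Function.ne_iff.mp hw
  obtain ⟨b, hb⟩ := Function.ne_iff.mp (hvw (v c / w c))
  have unit_mem {r : K} (hr : r ≠ 0) {x : MvPolynomial (Fin (n + 1)) K} (h : C r * x ∈ P) :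
      x ∈ P := by
    have := P.mul_mem_left (C r⁻¹) h
    rwa [← mul_assoc, ← C_mul, inv_mul_cancel₀ hr, C_1, one_mul] at this
  have hXc : X c ∈ P := by
    have hr : v c * w b - v b * w c ≠ 0 := by
      intro h
      apply hb
      rw [Pi.smul_apply, smul_eq_mul]
      field_simp [show w c ≠ 0 from hc]
      linear_combination -h
    refine unit_mem hr ?_
    have : C (v c * w b - v b * w c) * X c =
        C (w c) * minorForm v c b - C (v c) * minorForm w c b := by
      simp only [minorForm, map_sub, map_mul]
      ring
    rw [this]
    exact P.sub_mem (P.mul_mem_left _ (hv (minorForm_mem_pointIdeal v c b)))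
      (P.mul_mem_left _ (hw' (minorForm_mem_pointIdeal w c b)))
  refine unit_mem hc ?_
  have : C (w c) * X a = minorForm w c a + C (w a) * X c := by rw [minorForm]; ring
  rw [this]
  exact P.add_mem (hw' (minorForm_mem_pointIdeal w c a)) (P.mul_mem_left _ hXc)

lemma isHomogeneous_pointIdeal (v : Fin (n + 1) → K) :
    (pointIdeal v).IsHomogeneous (homogeneousSubmodule (Fin (n + 1)) K) :=
  Ideal.homogeneous_span _ _ fun _ hF => hF.1

lemma Ideal.IsHomogeneous.pow {ι σ A : Type*} [CommSemiring A] [DecidableEq ι] [AddMonoid ι]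
    [SetLike σ A] [AddSubmonoidClass σ A] {𝒜 : ι → σ} [GradedRing 𝒜] {I : Ideal A}
    (hI : I.IsHomogeneous 𝒜) (k : ℕ) : (I ^ k).IsHomogeneous 𝒜 := by
  induction k with
  | zero => rw [pow_zero, Ideal.one_eq_top]; exact Ideal.IsHomogeneous.top _
  | succ k ih => rw [pow_succ]; exact ih.mul hI

/-- If `m^N I ⊆ Q` for a homogeneous ideal `I`, with `m` the irrelevant ideal, then `Q`
contains `I` in large degrees. -/
lemma exists_forall_isHomogeneous_mem {I Q : Ideal (MvPolynomial (Fin (n + 1)) K)}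
    (hI : I.IsHomogeneous (homogeneousSubmodule (Fin (n + 1)) K)) {N : ℕ}
    (hN : idealOfVars (Fin (n + 1)) K ^ N * I ≤ Q) :
    ∃ i₀ : ℕ, ∀ i ≥ i₀, ∀ F : MvPolynomial (Fin (n + 1)) K, F.IsHomogeneous i → F ∈ I → F ∈ Q := by
  have hm : (idealOfVars (Fin (n + 1)) K).IsHomogeneous
      (homogeneousSubmodule (Fin (n + 1)) K) := by
    refine Ideal.homogeneous_span _ _ ?_
    rintro _ ⟨i, rfl⟩
    exact ⟨1, isHomogeneous_X K i⟩
  obtain ⟨S, hS⟩ := IsNoetherian.noetherian I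
  have remainder : ∀ F ∈ I, ∃ R, F - R ∈ idealOfVars (Fin (n + 1)) K ^ N * I ∧
      R.totalDegree ≤ N + S.sup totalDegree := by
    intro F hF
    rw [← hS] at hF
    obtain ⟨a, rfl⟩ := Submodule.mem_span_finset'.mp hF
    refine ⟨∑ f : S, (∑ d ∈ Finset.range N, homogeneousComponent d (a f)) * f.1, ?_, ?_⟩
    · rw [← Finset.sum_sub_distrib]
      refine Ideal.sum_mem _ fun f _ => ?_
      rw [smul_eq_mul, ← sub_mul]
      refine Ideal.mul_mem_mul ?_ (hS ▸ Submodule.subset_span f.2)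
      rw [mem_pow_idealOfVars_iff']
      intro x hx
      simp [coeff_sum, coeff_homogeneousComponent, hx]
    · refine totalDegree_finsetSum_le fun f _ => (totalDegree_mul _ _).trans ?_
      refine add_le_add (totalDegree_finsetSum_le fun d hd => ?_) (Finset.le_sup f.2)
      exact (homogeneousComponent_isHomogeneous d _).totalDegree_le.trans
        (Finset.mem_range.mp hd).le
  refine ⟨N + S.sup totalDegree + 1, fun i hi F hF hFI => hN ?_⟩
  obtain ⟨R, hR, hdeg⟩ := remainder F hFI
  have := homogeneousComponent_mem_of_mem ((hm.pow N).mul hI) hR i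
  rwa [map_sub, homogeneousComponent_eq_self hF, homogeneousComponent_eq_zero i R (by omega),
    sub_zero] at this

/-- Every variable lies in the radical of `(∂(I_X^{k+1} I_Y^ℓ) : I_X^k I_Y^ℓ)`. -/
lemma idealOfVars_le_radical_colon [CharZero K] {s : ℕ} (hs : 2 ≤ s) {v : Fin s → Fin (n + 1) → K}
    (hv0 : ∀ j, v j ≠ 0) (hdist : ∀ i j, i ≠ j → ∀ c : K, v i ≠ c • v j)
    (T : Finset (Fin s)) (k ℓ : ℕ) {IX IY J : Ideal (MvPolynomial (Fin (n + 1)) K)}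
    (hIX : IX = ⨅ j, pointIdeal (v j)) (hIY : IY = ⨅ j ∈ T, pointIdeal (v j))
    (hJdef : J = IX ^ (k + 1) * IY ^ ℓ) (hJ : J ≤ partialsIdeal J) :
    idealOfVars (Fin (n + 1)) K ≤
      ((partialsIdeal J).colon (IX ^ k * IY ^ ℓ : Ideal _)).radical := by
  rw [Ideal.radical_eq_sInf]
  refine le_sInf ?_
  rintro P ⟨hP, hprime⟩
  by_contra hvars
  have not_two : ∀ i j, i ≠ j → pointIdeal (v i) ≤ P → ¬ pointIdeal (v j) ≤ P := by
    intro i j hij hi hj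
    refine hvars (Ideal.span_le.mpr ?_)
    rintro _ ⟨a, rfl⟩
    exact X_mem_of_pointIdeal_le (hv0 j) (hdist i j hij) hi hj a
  have hXP : IX ≤ P := by
    intro f hf
    refine hP (Submodule.mem_colon.mpr fun G hG => hJ ?_)
    rw [hJdef, pow_succ', mul_assoc]
    exact Ideal.mul_mem_mul hf hG
  obtain ⟨j, hj⟩ : ∃ j, pointIdeal (v j) ≤ P := by
    rw [hIX, ← Finset.inf_univ_eq_iInf, hprime.inf_le'] at hXP
    simpa using hXP
  obtain ⟨h, hhP, hh⟩ : ∃ h ∉ P, ∀ i, i ≠ j → h ∈ pointIdeal (v i) := by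
    have : ¬ (Finset.univ.erase j).inf (fun i => pointIdeal (v i)) ≤ P := by
      rw [hprime.inf_le']
      rintro ⟨i, hi, hiP⟩
      exact not_two i j (Finset.ne_of_mem_erase hi) hiP hj
    obtain ⟨h, hmem, hhP⟩ := SetLike.not_le_iff_exists.mp this
    refine ⟨h, hhP, fun i hi => ?_⟩
    exact Finset.inf_le (f := fun i => pointIdeal (v i))
      (Finset.mem_erase.mpr ⟨hi, Finset.mem_univ i⟩) hmem
  have hX : Ideal.span {h} * pointIdeal (v j) ≤ IX := by
    rw [hIX]
    refine le_iInf fun i => ?_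
    by_cases hi : i = j
    · rw [hi]
      exact Ideal.mul_le_right
    · exact Ideal.mul_le_left.trans (by simpa using hh i hi)
  obtain ⟨r, hYle, hleY⟩ : ∃ r, IY ^ ℓ ≤ pointIdeal (v j) ^ r ∧
      Ideal.span {h} ^ ℓ * pointIdeal (v j) ^ r ≤ IY ^ ℓ := by
    by_cases hjT : j ∈ T
    · refine ⟨ℓ, Ideal.pow_right_mono (hIY ▸ iInf₂_le j hjT) ℓ, ?_⟩
      rw [← mul_pow]
      refine Ideal.pow_right_mono (hX.trans ?_) ℓ
      rw [hIX, hIY]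
      exact le_iInf₂ fun i _ => iInf_le _ i
    · refine ⟨0, by simp, ?_⟩
      rw [pow_zero, mul_one]
      refine Ideal.pow_right_mono (hIY ▸ le_iInf₂ fun i hi => ?_) ℓ
      simpa using hh i (fun hij => hjT (hij ▸ hi))
  obtain ⟨c, hc⟩ := Function.ne_iff.mp (hv0 j)
  obtain ⟨a, ha⟩ : ∃ a, a ≠ c := by
    by_contra! hall
    have : Nontrivial (Fin s) := Fin.nontrivial_iff_two_le.mpr hs
    obtain ⟨i, hi⟩ := exists_ne j
    refine hdist i j hi (v i c / v j c) (funext fun b => ?_)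
    rw [hall b, Pi.smul_apply, smul_eq_mul, div_mul_cancel₀ _ hc]
  have hXj : IX ≤ pointIdeal (v j) := hIX ▸ iInf_le _ j
  have hg : ∀ G ∈ pointIdeal (v j) ^ (k + r + 1), h ^ (k + 1 + ℓ) * G ∈ J := by
    intro G hG
    rw [hJdef]
    have hle : Ideal.span {h} ^ (k + 1 + ℓ) * pointIdeal (v j) ^ (k + r + 1) ≤
        IX ^ (k + 1) * IY ^ ℓ := by
      calc _ = (Ideal.span {h} * pointIdeal (v j)) ^ (k + 1) *
            (Ideal.span {h} ^ ℓ * pointIdeal (v j) ^ r) := by ring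
        _ ≤ _ := Ideal.mul_mono (Ideal.pow_right_mono hX _) hleY
    exact hle (Ideal.mul_mem_mul (Ideal.pow_mem_pow (Ideal.mem_span_singleton_self h) _) hG)
  refine hhP (hprime.mem_of_pow_mem (k + 1 + ℓ) (hprime.mem_of_pow_mem 2 (hP ?_)))
  refine Submodule.mem_colon.mpr fun G hG => sq_mul_mem_partialsIdeal hc ha hJ hg ?_
  rw [pow_add]
  exact Ideal.mul_mono (Ideal.pow_right_mono hXj k) hYle hG

end PartialsOfPointIdeals

/-- Let `X` be a set of `s ≥ 2` distinct points in `ℙ^n` (char K = 0),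
let `Y` be a nonempty subset of `X`, and let `k, ℓ ≥ 0`. Then for all sufficiently large
`i`, `(I_X^k · I_Y^ℓ)_i ⊆ (∂(I_X^{k+1} · I_Y^ℓ))_i`. -/
theorem product_subset_partials_in_large_degrees {K : Type*} [Field K] [CharZero K]
    (n s : ℕ) (hs : 2 ≤ s)
    (v : Fin s → (Fin (n + 1) → K))
    (hv0 : ∀ j, v j ≠ 0)
    (hdist : ∀ i j, i ≠ j → ∀ c : K, v i ≠ c • v j)
    (T : Finset (Fin s)) (hT : T.Nonempty)
    (k ℓ : ℕ) :
    ∃ i₀ : ℕ, ∀ i ≥ i₀, ∀ F : MvPolynomial (Fin (n + 1)) K, F.IsHomogeneous i →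
      F ∈ (⨅ j, pointIdeal (v j)) ^ k * (⨅ j ∈ T, pointIdeal (v j)) ^ ℓ →
      F ∈ partialsIdeal
        ((⨅ j, pointIdeal (v j)) ^ (k + 1) * (⨅ j ∈ T, pointIdeal (v j)) ^ ℓ) := by
  let := MvPolynomial.gradedAlgebra (σ := Fin (n + 1)) (R := K)
  set IX := ⨅ j, pointIdeal (v j) with hIX
  set IY := ⨅ j ∈ T, pointIdeal (v j) with hIY
  set J := IX ^ (k + 1) * IY ^ ℓ with hJdef
  have homX : IX.IsHomogeneous (homogeneousSubmodule (Fin (n + 1)) K) :=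
    Ideal.IsHomogeneous.iInf fun j => isHomogeneous_pointIdeal (v j)
  have homY : IY.IsHomogeneous (homogeneousSubmodule (Fin (n + 1)) K) :=
    Ideal.IsHomogeneous.iInf₂ fun j _ => isHomogeneous_pointIdeal (v j)
  have hJ : J ≤ partialsIdeal J := le_partialsIdeal ((homX.pow _).mul (homY.pow _))
  obtain ⟨N, hN⟩ := Ideal.exists_pow_le_of_le_radical_of_fg
    (idealOfVars_le_radical_colon hs hv0 hdist T k ℓ hIX hIY hJdef hJ) (idealOfVars_fg _ _)
  refine exists_forall_isHomogeneous_mem ((homX.pow _).mul (homY.pow _)) (N := N) ?_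
  exact Ideal.mul_le.mpr fun a ha b hb => Submodule.mem_colon.mp (hN ha) b hb
end
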